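/- If b ≥ 2, n is self-descriptive in base b, and the digit of n at position 1 (the coefficient of b^(b−2), counting occurrences of the digit 1 in n) is at most 1, then the leading digit of n (the digit at position 0, counting occurrences of the digit 0 in n) equals 2, and consequently the digit of n at position 2 equals 2. -/

import Mathlib

/-- `n` is self-descriptive in base `b`: its base-`b` digit list has length exactly `b`,
and for every `i < b`, the digit at position `i` counted from the most significant digit
(i.e. the coefficient of `b ^ (b - 1 - i)`) equals the number of occurrences of the
value `i` among the base-`b` digits of `n`. -/
def IsSelfDescriptive (b n : ℕ) : Prop :=
  (Nat.digits b n).length = b ∧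
  ∀ i < b, n / b ^ (b - 1 - i) % b = (Nat.digits b n).count i

theorem comb_aux (b : ℕ) (d : ℕ → ℕ) (hb : 2 ≤ b) (hlt : ∀ i, d i < b)
    (hd : ∀ v < b, d v = ((Finset.range b).filter (fun i => d i = v)).card) (h1 : d 1 ≤ 1) :
    3 ≤ b ∧ d 0 = 2 ∧ d 2 = 2 := by
  have hsum : ∑ i ∈ Finset.range b, d i = b := by
    have := Finset.card_eq_sum_card_fiberwise (s := Finset.range b) (t := Finset.range b)
      (f := d) (fun i _ => by simpa using hlt i)
    rw [Finset.card_range] at this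
    rw [Finset.sum_congr rfl (fun v hv => hd v (Finset.mem_range.1 hv))]
    exact this.symm
  have mem : ∀ i < b, ∀ v < b, d i = v → 0 < d v := by
    intro i hi v hv h
    rw [hd v hv]
    exact Finset.card_pos.2 ⟨i, by simp [hi, h]⟩
  have h0 : d 0 ≠ 0 := by
    intro h
    have := mem 0 (by omega) 0 (by omega) h
    omega
  have hsum2 : ∑ i ∈ Finset.range b, (d i - 1) = d 0 := by
    have e : ∑ i ∈ Finset.range b, ((d i - 1) + 1) =
        ∑ i ∈ Finset.range b, (d i + if d i = 0 then 1 else 0) := by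
      apply Finset.sum_congr rfl
      intro i _
      split_ifs <;> omega
    rw [Finset.sum_add_distrib, Finset.sum_add_distrib, hsum, ← Finset.card_filter,
      ← hd 0 (by omega)] at e
    simp at e
    omega
  have hsum3 : ∑ i ∈ (Finset.range b).erase 0, (d i - 1) = 1 := by
    have := Finset.add_sum_erase (Finset.range b) (fun i => d i - 1)
      (Finset.mem_range.2 (by omega : 0 < b))
    omega
  obtain ⟨k, hk, hk0⟩ := Finset.exists_ne_zero_of_sum_ne_zero (by rw [hsum3]; exact one_ne_zero)
  have hsplit := Finset.add_sum_erase _ (fun i => d i - 1) hk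
  have huniq : ∀ i, 1 ≤ i → i < b → i ≠ k → d i ≤ 1 := by
    intro i hi hib hik
    have : d i - 1 ≤ ∑ i ∈ ((Finset.range b).erase 0).erase k, (d i - 1) :=
      Finset.single_le_sum (f := fun i => d i - 1) (fun _ _ => Nat.zero_le _)
        (by simp; omega)
    omega
  have hdk : d k = 2 := by omega
  simp only [Finset.mem_erase, Finset.mem_range] at hk
  have hk1 : k ≠ 1 := by rintro rfl; omega
  have hb3 : 3 ≤ b := by omega
  have h2 : 0 < d 2 := mem k hk.2 2 (by omega) hdk
  have two : ∀ v < b, ∀ i < b, ∀ j < b, i ≠ j → d i = v → d j = v → 1 < d v := by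
    intro v hv i hi j hj hij e1 e2
    rw [hd v hv]
    exact Finset.one_lt_card.2 ⟨i, by simp [hi, e1], j, by simp [hj, e2], hij⟩
  have hk2 : k = 2 := by
    by_contra hne
    have h21 : d 2 = 1 := by
      have := huniq 2 (by omega) (by omega) (Ne.symm hne)
      omega
    have := mem 2 (by omega) 1 (by omega) h21
    have := two 1 (by omega) 1 (by omega) 2 (by omega) (by omega) (by omega) h21
    omega
  subst hk2
  refine ⟨hb3, ?_, hdk⟩
  have hc := hd 2 (by omega)
  rw [hdk] at hc
  obtain ⟨i, hi, hi2⟩ := Finset.exists_mem_ne (by rw [← hc]; omega) 2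
  simp only [Finset.mem_filter, Finset.mem_range] at hi
  rcases Nat.eq_zero_or_pos i with rfl | hpos
  · exact hi.2
  · have := huniq i hpos hi.1 hi2
    omega

theorem count_aux (L : List ℕ) (v : ℕ) :
    L.count v = ((Finset.range L.length).filter
      (fun i => L.getD (L.length - 1 - i) 0 = v)).card := by
  induction L with
  | nil => simp
  | cons a L ih =>
    rw [List.count_cons, ih, List.length_cons, Finset.range_add_one, Finset.filter_insert]
    have e : (Finset.range L.length).filter
        (fun i => (a :: L).getD (L.length + 1 - 1 - i) 0 = v) =
        (Finset.range L.length).filter (fun i => L.getD (L.length - 1 - i) 0 = v) := by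
      apply Finset.filter_congr
      intro i hi
      rw [Finset.mem_range] at hi
      have : L.length + 1 - 1 - i = (L.length - 1 - i) + 1 := by omega
      rw [this, List.getD_cons_succ]
    rw [e]
    by_cases hav : a = v <;> simp [hav]

theorem digit_one_le_one_case (b n : ℕ) (hb : 2 ≤ b) (h : IsSelfDescriptive b n)
    (h1 : n / b ^ (b - 2) % b ≤ 1) :
    n / b ^ (b - 1) % b = 2 ∧ n / b ^ (b - 1 - 2) % b = 2 := by
  obtain ⟨hl, hc⟩ := h
  have key := comb_aux b (fun i => n / b ^ (b - 1 - i) % b) hb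
    (fun i => Nat.mod_lt _ (by omega)) (by
      intro v hv
      rw [hc v hv, count_aux, hl]
      simp only [Nat.getD_digits _ _ hb]) (by
      simpa [Nat.sub_sub] using h1)
  exact ⟨by simpa using key.2.1, key.2.2⟩
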